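/- Let X be a Banach two-sided ℍ-module, let D(A) be a right ℍ-submodule of X, and let A : D(A) → X be a closed right linear operator such that ρ_S(A) ∩ ℝ ≠ ∅. Let q0 ∈ ρ_S(A) and set R := ‖Q_{q0}(A)‖^{−1/2}. Then the Cassini ball U(q0,R) is contained in ρ_S(A). -/

import Mathlib

open MulOpposite Filter Topology Classical

noncomputable section

notation "ℍ" => Quaternion ℝ

/-- A *Banach two-sided `ℍ`-module*: a two-sided `ℍ`-module (left `ℍ`-action, right
`ℍ`-action encoded as a left `ℍᵐᵒᵖ`-action) whose complete norm satisfies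
`‖qx‖ = ‖xq‖ = |q|‖x‖`, and where real scalars act the same on both sides. -/
class QuatBimodule (Y : Type*) [NormedAddCommGroup Y]
    [Module ℍ Y] [Module ℍᵐᵒᵖ Y] : Prop where
  smul_op_comm : ∀ (p q : ℍ) (y : Y), p • (op q • y) = op q • (p • y)
  norm_smul_left : ∀ (q : ℍ) (y : Y), ‖q • y‖ = ‖q‖ * ‖y‖
  norm_smul_right : ∀ (q : ℍ) (y : Y), ‖op q • y‖ = ‖q‖ * ‖y‖
  real_smul_comm : ∀ (r : ℝ) (y : Y), ((r : ℝ) : ℍ) • y = op ((r : ℝ) : ℍ) • y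

variable {X : Type*} [NormedAddCommGroup X] [Module ℍ X] [Module ℍᵐᵒᵖ X]

/-- Membership in `Lin^r(X)`: additive, right `ℍ`-linear, with finite operator
norm (i.e. `‖B x‖` is bounded on the closed unit ball). -/
def MemLinR (B : X → X) : Prop :=
  (∀ x y : X, B (x + y) = B x + B y) ∧
  (∀ (q : ℍ) (x : X), B (op q • x) = op q • B x) ∧
  BddAbove ((fun x : X => ‖B x‖) '' {x : X | ‖x‖ ≤ 1})

/-- The operator norm `‖B‖ = sup {‖B x‖ : ‖x‖ ≤ 1}`. -/
def opNorm (B : X → X) : ℝ :=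
  sSup ((fun x : X => ‖B x‖) '' {x : X | ‖x‖ ≤ 1})

/-- A right linear operator `A : D(A) → X`, where `D(A)` is a right `ℍ`-submodule
of `X`.  It is encoded as a function `X → X` together with its domain; only the
values on the domain are relevant. -/
structure RightLinearOp (X : Type*) [NormedAddCommGroup X]
    [Module ℍ X] [Module ℍᵐᵒᵖ X] where
  dom : Set X
  toFun : X → X
  zero_mem : (0 : X) ∈ dom
  add_mem : ∀ ⦃x⦄, x ∈ dom → ∀ ⦃y⦄, y ∈ dom → x + y ∈ dom
  neg_mem : ∀ ⦃x⦄, x ∈ dom → -x ∈ dom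
  smulR_mem : ∀ (q : ℍ) ⦃x⦄, x ∈ dom → op q • x ∈ dom
  map_add' : ∀ ⦃x⦄, x ∈ dom → ∀ ⦃y⦄, y ∈ dom → toFun (x + y) = toFun x + toFun y
  map_smulR' : ∀ (q : ℍ) ⦃x⦄, x ∈ dom → toFun (op q • x) = op q • toFun x

namespace RightLinearOp

variable (T : RightLinearOp X)

/-- `A` is closed: its graph is closed in `X × X`. -/
def IsClosedOp : Prop := IsClosed {p : X × X | p.1 ∈ T.dom ∧ T.toFun p.1 = p.2}

/-- The domain `D(A²)` of `A²`. -/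
def dom2 : Set X := {x | x ∈ T.dom ∧ T.toFun x ∈ T.dom}

/-- The operator `Δ_q(A) = A² − 2 Re(q) A + |q|² Id`, with domain `D(A²)`. -/
def delta (q : ℍ) (x : X) : X :=
  T.toFun (T.toFun x) - ((2 * q.re : ℝ) : ℍ) • T.toFun x + ((‖q‖ ^ 2 : ℝ) : ℍ) • x

/-- `B` is the inverse of `Δ_q(A) : D(A²) → X`, and `B ∈ Lin^r(X)`. -/
def IsQInv (q : ℍ) (B : X → X) : Prop :=
  MemLinR B ∧ (∀ x : X, B x ∈ T.dom2) ∧ (∀ x : X, T.delta q (B x) = x) ∧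
    ∀ x ∈ T.dom2, B (T.delta q x) = x

/-- The S-resolvent set `ρ_S(A)`. -/
def rhoS : Set ℍ := {q | ∃ B : X → X, T.IsQInv q B}

/-- `Q_q(A) = Δ_q(A)⁻¹ ∈ Lin^r(X)`, for `q ∈ ρ_S(A)` (junk value otherwise). -/
def qres (q : ℍ) : X → X :=
  if h : q ∈ T.rhoS then h.choose else fun _ => 0

/-- The (left) S-resolvent operator `S_q⁻¹(A) = Q_q(A) q̄ − A Q_q(A)`, where the
right scalar multiple of an operator is `(B q̄)(x) = B(q̄ x)`. -/
def sres (q : ℍ) : X → X :=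
  fun x => T.qres q (star q • x) - T.toFun (T.qres q x)

/-- The coefficients `B_n`: `B_{2k} = Q_{q0}(A)^k`, `B_{2k+1} = Q_{q0}(A)^k S_{q0}⁻¹(A)`. -/
def Bop (q0 : ℍ) (n : ℕ) : X → X :=
  if n % 2 = 0 then (T.qres q0)^[n / 2] else (T.qres q0)^[n / 2] ∘ T.sres q0

end RightLinearOp

/-- The quaternionic polynomial `Δ_q(p) = p² − 2 Re(q) p + |q|²`. -/
def deltaPoly (q p : ℍ) : ℍ :=
  p ^ 2 - ((2 * q.re : ℝ) : ℍ) * p + ((‖q‖ ^ 2 : ℝ) : ℍ)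

/-- The "powers" `p_{q0,n}`: `p_{q0,2k}(q) = Δ_{q0}(q)^k`,
`p_{q0,2k+1}(q) = (q − q0) Δ_{q0}(q)^k`. -/
def spow (q0 : ℍ) (n : ℕ) (q : ℍ) : ℍ :=
  if n % 2 = 0 then deltaPoly q0 q ^ (n / 2) else (q - q0) * deltaPoly q0 q ^ (n / 2)

/-- The Cassini pseudo-metric `u(p,q) = √|Δ_q(p)|`. -/
def cassini (p q : ℍ) : ℝ := Real.sqrt ‖deltaPoly q p‖

/-- The Cassini ball `U(q0,R)`. -/
def cassiniBall (q0 : ℍ) (R : ℝ) : Set ℍ := {p : ℍ | cassini p q0 < R}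

/-- The Cassini topology on `ℍ`: the topology induced by the Cassini pseudo-metric,
i.e. the topology generated by the Cassini balls. -/
def cassiniTopology : TopologicalSpace ℍ :=
  TopologicalSpace.generateFrom {U : Set ℍ | ∃ q0 R, 0 < R ∧ U = cassiniBall q0 R}

/-- The spherical derivative of a function `g : ℍ → ℍ`. -/
def sderivQ (g : ℍ → ℍ) (q : ℍ) : ℍ :=
  if q.im = 0 then deriv (fun t : ℝ => g ((t : ℝ) : ℍ)) q.re
  else (g q - g (star q)) * (q - star q)⁻¹

end

namespace QuatBimodule

variable {X : Type*} [NormedAddCommGroup X] [Module ℍ X] [Module ℍᵐᵒᵖ X] [QuatBimodule X]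

/-- The real normed space structure obtained by restricting the right action to real scalars. -/
noncomputable abbrev realNormedSpace (X : Type*) [NormedAddCommGroup X] [Module ℍ X] [Module ℍᵐᵒᵖ X]
    [QuatBimodule X] : NormedSpace ℝ X :=
  { Module.compHom X (algebraMap ℝ ℍᵐᵒᵖ) with
    norm_smul_le := fun r x => by
      refine (norm_smul_right (r : ℍ) x).le.trans ?_
      simp }

theorem continuous_op_smul (q : ℍ) : Continuous fun x : X => op q • x := by
  have h : LipschitzWith ‖q‖₊ fun x : X => op q • x :=
    LipschitzWith.of_dist_le_mul fun x y => by
      rw [dist_eq_norm, dist_eq_norm, ← smul_sub, norm_smul_right]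
      rfl
  exact h.continuous

theorem norm_apply_le_opNorm {B : X → X} (hB : MemLinR B) (x : X) :
    ‖B x‖ ≤ opNorm B * ‖x‖ := by
  obtain ⟨hadd, hsmul, hbdd⟩ := hB
  rcases eq_or_ne x 0 with rfl | hx
  · have h0 : B 0 = 0 := by simpa using hadd 0 0
    simp [h0]
  have hx' : 0 < ‖x‖ := norm_pos_iff.2 hx
  have hle : ‖B (op ((‖x‖⁻¹ : ℝ) : ℍ) • x)‖ ≤ opNorm B := by
    refine le_csSup hbdd ⟨_, ?_, rfl⟩
    simp only [Set.mem_ofPred_eq, norm_smul_right, Quaternion.norm_coe, norm_inv, norm_norm]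
    exact (inv_mul_cancel₀ hx'.ne').le
  rw [hsmul, norm_smul_right, Quaternion.norm_coe, norm_inv, norm_norm,
    inv_mul_le_iff₀ hx'] at hle
  linarith

theorem exists_sub_op_smul_eq [CompleteSpace X] {B : X → X} (hB : MemLinR B) {c : ℍ}
    (hc : ‖c‖ * opNorm B < 1) (y : X) : ∃ v, v - op c • B v = y := by
  let := realNormedSpace X
  let F : X →ₗ[ℝ] X :=
    { toFun := fun x => B (op c • x)
      map_add' := fun x y => by rw [smul_add, hB.1]
      map_smul' := fun r x => by
        change B (op c • (op (r : ℍ) • x)) = op (r : ℍ) • B (op c • x)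
        rw [← hB.2.1, smul_smul, smul_smul, ← op_mul, ← op_mul, Quaternion.coe_commutes] }
  have hF : ∀ x, ‖F x‖ ≤ ‖c‖ * opNorm B * ‖x‖ := fun x =>
    (norm_apply_le_opNorm hB _).trans (by rw [norm_smul_right]; exact le_of_eq (by ring))
  have hN : 0 ≤ opNorm B := Real.sSup_nonneg (by rintro _ ⟨x, -, rfl⟩; exact norm_nonneg _)
  let G : X →L[ℝ] X := F.mkContinuous _ hF
  have hG : ‖G‖ < 1 := (F.mkContinuous_norm_le (by positivity) hF).trans_lt hc
  obtain ⟨u, hu⟩ := isUnit_one_sub_of_norm_lt_one hG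
  refine ⟨(↑u⁻¹ : X →L[ℝ] X) y, ?_⟩
  rw [← hB.2.1]
  have h : (1 - G) ((↑u⁻¹ : X →L[ℝ] X) y) = y := by
    rw [← hu, ← mul_apply_eq_comp, Units.mul_inv]
    rfl
  exact h

end QuatBimodule

theorem deltaPoly_star (q p : ℍ) : deltaPoly q (star p) = star (deltaPoly q p) := by
  simp only [deltaPoly, star_add, star_sub, star_mul, star_pow, Quaternion.star_coe,
    Quaternion.coe_commutes]

theorem norm_deltaPoly_mul_lt_one {q p : ℍ} {N : ℝ}
    (hp : p ∈ cassiniBall q (Real.sqrt N)⁻¹) : ‖deltaPoly q p‖ * N < 1 := by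
  change Real.sqrt ‖deltaPoly q p‖ < (Real.sqrt N)⁻¹ at hp
  have hpos : 0 < Real.sqrt N := inv_pos.1 ((Real.sqrt_nonneg _).trans_lt hp)
  rw [← one_div, lt_div_iff₀ hpos, ← Real.sqrt_mul (norm_nonneg _), Real.sqrt_lt' one_pos,
    one_pow] at hp
  exact hp

namespace RightLinearOp

variable {X : Type*} [NormedAddCommGroup X] [Module ℍ X] [Module ℍᵐᵒᵖ X]
  (T : RightLinearOp X)

/-- The operator `x ↦ A x - x p`. -/
noncomputable def subRight (p : ℍ) (x : X) : X := T.toFun x - op p • x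

variable {T}

theorem sub_mem {x y : X} (hx : x ∈ T.dom) (hy : y ∈ T.dom) : x - y ∈ T.dom := by
  rw [sub_eq_add_neg]
  exact T.add_mem hx (T.neg_mem hy)

theorem map_sub {x y : X} (hx : x ∈ T.dom) (hy : y ∈ T.dom) :
    T.toFun (x - y) = T.toFun x - T.toFun y := by
  have h := T.map_add' (sub_mem hx hy) hy
  rw [sub_add_cancel] at h
  rw [h, add_sub_cancel_right]

theorem subRight_mem {p : ℍ} {x : X} (hx : x ∈ T.dom2) : T.subRight p x ∈ T.dom :=
  sub_mem hx.2 (T.smulR_mem p hx.1)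

theorem mem_dom2_of_subRight_mem {p : ℍ} {x : X} (hx : x ∈ T.dom)
    (h : T.subRight p x ∈ T.dom) : x ∈ T.dom2 := by
  refine ⟨hx, ?_⟩
  rw [← sub_add_cancel (T.toFun x) (op p • x)]
  exact T.add_mem h (T.smulR_mem p hx)

theorem subRight_subRight {p w : ℍ} {x : X} (hx : x ∈ T.dom2) :
    T.subRight p (T.subRight w x) =
      T.toFun (T.toFun x) - op (p + w) • T.toFun x + op (w * p) • x := by
  simp only [subRight]
  rw [map_sub hx.2 (T.smulR_mem w hx.1), T.map_smulR' w hx.1, op_mul, ← smul_smul, op_add,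
    add_smul, smul_sub]
  abel

theorem subRight_sub {p : ℍ} {x y : X} (hx : x ∈ T.dom) (hy : y ∈ T.dom) :
    T.subRight p (x - y) = T.subRight p x - T.subRight p y := by
  simp only [subRight, map_sub hx hy, smul_sub]
  abel

theorem eq_of_subRight_eq {p : ℍ} (hinj : ∀ x ∈ T.dom, T.subRight p x = 0 → x = 0) {x y : X}
    (hx : x ∈ T.dom) (hy : y ∈ T.dom) (h : T.subRight p x = T.subRight p y) : x = y :=
  sub_eq_zero.1 <| hinj _ (sub_mem hx hy) (by rw [subRight_sub hx hy, h, sub_self])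

theorem delta_add {q : ℍ} {x y : X} (hx : x ∈ T.dom2) (hy : y ∈ T.dom2) :
    T.delta q (x + y) = T.delta q x + T.delta q y := by
  simp only [delta]
  rw [T.map_add' hx.1 hy.1, T.map_add' hx.2 hy.2, smul_add, smul_add]
  abel

section

variable [QuatBimodule X]

theorem delta_eq (q : ℍ) (x : X) : T.delta q x =
    T.toFun (T.toFun x) - op ((2 * q.re : ℝ) : ℍ) • T.toFun x + op ((‖q‖ ^ 2 : ℝ) : ℍ) • x := by
  rw [delta, QuatBimodule.real_smul_comm, QuatBimodule.real_smul_comm]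

theorem subRight_subRight_star {q : ℍ} {x : X} (hx : x ∈ T.dom2) :
    T.subRight q (T.subRight (star q) x) = T.delta q x := by
  rw [subRight_subRight hx, delta_eq, Quaternion.self_add_star, Quaternion.star_mul_self,
    Quaternion.normSq_eq_norm_mul_self, sq, Quaternion.coe_mul 2]
  rfl

theorem delta_sub_op_smul {q p : ℍ} {x : X} :
    T.delta q x - op (deltaPoly q p) • x =
      T.toFun (T.toFun x) - op ((2 * q.re : ℝ) : ℍ) • T.toFun x +
        op ((((2 * q.re : ℝ) : ℍ) - p) * p) • x := by
  rw [delta_eq, deltaPoly, sub_mul, ← sq]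
  simp only [op_add, op_sub, add_smul, sub_smul]
  abel

theorem subRight_subRight_eq_delta_sub {q p : ℍ} {x : X} (hx : x ∈ T.dom2) :
    T.subRight p (T.subRight (((2 * q.re : ℝ) : ℍ) - p) x) =
      T.delta q x - op (deltaPoly q p) • x := by
  rw [subRight_subRight hx, delta_sub_op_smul, add_sub_cancel]

theorem subRight_subRight_eq_delta_sub_of_swap {q p : ℍ} {x : X} (hx : x ∈ T.dom2) :
    T.subRight (((2 * q.re : ℝ) : ℍ) - p) (T.subRight p x) =
      T.delta q x - op (deltaPoly q p) • x := by
  rw [subRight_subRight hx, delta_sub_op_smul, sub_add_cancel, mul_sub, sub_mul,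
    Quaternion.coe_commutes]

theorem eq_zero_of_subRight_eq_zero {q p : ℍ} {B : X → X} (hB : T.IsQInv q B)
    (hp : ‖deltaPoly q p‖ * opNorm B < 1) {x : X} (hx : x ∈ T.dom)
    (h : T.subRight p x = 0) : x = 0 := by
  have hx2 : x ∈ T.dom2 := mem_dom2_of_subRight_mem hx (h ▸ T.zero_mem)
  have h1 := subRight_subRight_eq_delta_sub_of_swap (q := q) (p := p) hx2
  have h0 : ∀ w : ℍ, T.subRight w 0 = 0 := fun w => by
    have := subRight_sub (p := w) T.zero_mem T.zero_mem
    simpa using this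
  rw [h, h0, eq_comm, sub_eq_zero] at h1
  have h2 := hB.2.2.2 x hx2
  rw [h1] at h2
  have h3 := QuatBimodule.norm_apply_le_opNorm hB.1 (op (deltaPoly q p) • x)
  rw [h2, QuatBimodule.norm_smul_right] at h3
  by_contra hne
  have : 0 < ‖x‖ := norm_pos_iff.2 hne
  nlinarith

theorem exists_subRight_eq [CompleteSpace X] {q p : ℍ} {B : X → X} (hB : T.IsQInv q B)
    (hp : ‖deltaPoly q p‖ * opNorm B < 1) (y : X) :
    ∃ x ∈ T.dom, T.subRight p x = y := by
  obtain ⟨v, hv⟩ := QuatBimodule.exists_sub_op_smul_eq hB.1 hp y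
  refine ⟨T.subRight (((2 * q.re : ℝ) : ℍ) - p) (B v), subRight_mem (hB.2.1 v), ?_⟩
  rw [subRight_subRight_eq_delta_sub (hB.2.1 v), hB.2.2.1, hv]

theorem exists_bounded_inverse_subRight [CompleteSpace X] (hT : T.IsClosedOp) {p : ℍ}
    (hinj : ∀ x ∈ T.dom, T.subRight p x = 0 → x = 0)
    (hsurj : ∀ y, ∃ x ∈ T.dom, T.subRight p x = y) :
    ∃ C, 0 ≤ C ∧ ∀ x ∈ T.dom, ‖x‖ ≤ C * ‖T.subRight p x‖ := by
  let := QuatBimodule.realNormedSpace X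
  choose G hG hGp using hsurj
  let F : X →ₗ[ℝ] X :=
    { toFun := G
      map_add' := fun x y => eq_of_subRight_eq hinj (hG _) (T.add_mem (hG _) (hG _)) <| by
        have hx := hGp x
        have hy := hGp y
        rw [hGp, subRight, T.map_add' (hG _) (hG _), smul_add]
        rw [subRight] at hx hy
        nth_rewrite 1 [← hx, ← hy]
        abel
      map_smul' := fun r x => eq_of_subRight_eq hinj (hG _) (T.smulR_mem (r : ℍ) (hG _)) <| by
        have hx := hGp x
        change T.subRight p (G (r • x)) = T.subRight p (op (r : ℍ) • G x)
        rw [hGp, subRight, T.map_smulR' _ (hG _), smul_smul, ← op_mul, Quaternion.coe_commutes,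
          op_mul, ← smul_smul, ← smul_sub]
        rw [subRight] at hx
        rw [hx]
        rfl }
  have hF : IsClosed (F.graph : Set (X × X)) := by
    have hcont : Continuous fun z : X × X => (z.2, z.1 + op p • z.2) :=
      continuous_snd.prodMk
        (continuous_fst.add ((QuatBimodule.continuous_op_smul p).comp continuous_snd))
    convert hT.preimage hcont using 1
    ext ⟨y, x⟩
    simp only [SetLike.mem_coe, LinearMap.mem_graph_iff, Set.mem_preimage, Set.mem_ofPred_eq]
    rw [← sub_eq_iff_eq_add]
    change x = G y ↔ x ∈ T.dom ∧ T.subRight p x = y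
    refine ⟨fun h => h ▸ ⟨hG y, hGp y⟩, fun h => ?_⟩
    exact eq_of_subRight_eq hinj h.1 (hG y) (h.2.trans (hGp y).symm)
  let L : X →L[ℝ] X := ⟨F, F.continuous_of_isClosed_graph hF⟩
  refine ⟨‖L‖, norm_nonneg _, fun x hx => ?_⟩
  have hLx : L (T.subRight p x) = x := eq_of_subRight_eq hinj (hG _) hx (hGp _)
  simpa only [hLx] using L.le_opNorm (T.subRight p x)

theorem delta_op_smul {q c : ℍ} {x : X} (hx : x ∈ T.dom2) :
    T.delta q (op c • x) = op c • T.delta q x := by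
  simp only [delta]
  rw [T.map_smulR' c hx.1, T.map_smulR' c hx.2, QuatBimodule.smul_op_comm,
    QuatBimodule.smul_op_comm, smul_add, smul_sub]

theorem mem_rhoS_of_subRight [CompleteSpace X] (hT : T.IsClosedOp) {p : ℍ}
    (hinj : ∀ x ∈ T.dom, T.subRight p x = 0 → x = 0)
    (hsurj : ∀ y, ∃ x ∈ T.dom, T.subRight p x = y)
    (hinj' : ∀ x ∈ T.dom, T.subRight (star p) x = 0 → x = 0)
    (hsurj' : ∀ y, ∃ x ∈ T.dom, T.subRight (star p) x = y) : p ∈ T.rhoS := by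
  obtain ⟨C, hC, hCb⟩ := exists_bounded_inverse_subRight hT hinj hsurj
  obtain ⟨C', hC', hCb'⟩ := exists_bounded_inverse_subRight hT hinj' hsurj'
  have hex : ∀ y, ∃ x ∈ T.dom2, T.delta p x = y := fun y => by
    obtain ⟨v, hv, hvy⟩ := hsurj y
    obtain ⟨x, hx, hxv⟩ := hsurj' v
    have hx2 : x ∈ T.dom2 := mem_dom2_of_subRight_mem hx (hxv ▸ hv)
    exact ⟨x, hx2, by rw [← subRight_subRight_star hx2, hxv, hvy]⟩
  have huniq : ∀ x ∈ T.dom2, ∀ y ∈ T.dom2, T.delta p x = T.delta p y → x = y := by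
    intro x hx y hy h
    rw [← subRight_subRight_star hx, ← subRight_subRight_star hy] at h
    exact eq_of_subRight_eq hinj' hx.1 hy.1
      (eq_of_subRight_eq hinj (subRight_mem hx) (subRight_mem hy) h)
  choose B hB hBp using hex
  refine ⟨B, ⟨fun x y => ?_, fun c x => ?_, C' * C, ?_⟩, hB, hBp,
    fun x hx => huniq _ (hB _) _ hx (hBp _)⟩
  · refine huniq _ (hB _) _ ⟨T.add_mem (hB x).1 (hB y).1, ?_⟩ ?_
    · rw [T.map_add' (hB x).1 (hB y).1]
      exact T.add_mem (hB x).2 (hB y).2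
    · rw [delta_add (hB x) (hB y), hBp, hBp, hBp]
  · refine huniq _ (hB _) _ ⟨T.smulR_mem c (hB x).1, ?_⟩ ?_
    · rw [T.map_smulR' c (hB x).1]
      exact T.smulR_mem c (hB x).2
    · rw [delta_op_smul (hB x), hBp, hBp]
  · rintro _ ⟨x, hx, rfl⟩
    change ‖x‖ ≤ 1 at hx
    have h1 := hCb _ (subRight_mem (p := star p) (hB x))
    rw [subRight_subRight_star (hB x), hBp] at h1
    calc ‖B x‖ ≤ C' * ‖T.subRight (star p) (B x)‖ := hCb' _ (hB x).1
      _ ≤ C' * (C * 1) := by gcongr; exact h1.trans (by gcongr)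
      _ = C' * C := by ring

end

theorem isQInv_qres {q : ℍ} (hq : q ∈ T.rhoS) : T.IsQInv q (T.qres q) := by
  rw [qres, dif_pos hq]
  exact hq.choose_spec

end RightLinearOp

/-- Theorem `T:main`(i): if `ρ_S(A) ∩ ℝ ≠ ∅`, `q0 ∈ ρ_S(A)` and
`R = ‖Q_{q0}(A)‖^{-1/2}`, then the Cassini ball `U(q0,R)` is contained in `ρ_S(A)`. -/
theorem stmt1 {X : Type*} [NormedAddCommGroup X] [CompleteSpace X]
    [Module ℍ X] [Module ℍᵐᵒᵖ X] [QuatBimodule X]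
    (T : RightLinearOp X) (hT : T.IsClosedOp)
    (hreal : ∃ r : ℝ, ((r : ℝ) : ℍ) ∈ T.rhoS)
    (q0 : ℍ) (hq0 : q0 ∈ T.rhoS) :
    cassiniBall q0 (Real.sqrt (opNorm (T.qres q0)))⁻¹ ⊆ T.rhoS := by
  intro p hp
  have hQ := RightLinearOp.isQInv_qres hq0
  have h := norm_deltaPoly_mul_lt_one hp
  have h' : ‖deltaPoly q0 (star p)‖ * opNorm (T.qres q0) < 1 := by
    rwa [deltaPoly_star, norm_star]
  exact RightLinearOp.mem_rhoS_of_subRight hT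
    (fun _ => RightLinearOp.eq_zero_of_subRight_eq_zero hQ h)
    (RightLinearOp.exists_subRight_eq hQ h)
    (fun _ => RightLinearOp.eq_zero_of_subRight_eq_zero hQ h')
    (RightLinearOp.exists_subRight_eq hQ h')
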